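/- Let φ := ⋀_{1≤i≤n} cᵢ be a propositional formula in 3-CNF with clauses cᵢ = ℓᵢ₁ ∨ ℓᵢ₂ ∨ ℓᵢ₃ over the variables x₁,…,xₘ, let cᵢ' := cᵢ[¬x₁/x₁',…,¬xₘ/xₘ'] be obtained by replacing every negated variable by a corresponding fresh primed variable, and let Σ := {Lcᵢ' : 1 ≤ i ≤ n} ∪ {xⱼ ∨ Lxⱼ', Lxⱼ ∨ xⱼ' : 1 ≤ j ≤ m}. Then the number of stable expansions of Σ equals the number of satisfying truth assignments of φ (i.e., the reduction is parsimonious). -/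

import Mathlib

/-- Autoepistemic formulas: propositional variables, Boolean connectives
`⊤, ⊥, ¬, ∧, ∨, ⊕`, and the modal operator `L` (`box`). -/
inductive AE : Type
  | var : ℕ → AE
  | top : AE
  | bot : AE
  | neg : AE → AE
  | conj : AE → AE → AE
  | disj : AE → AE → AE
  | xor : AE → AE → AE
  | box : AE → AE
  deriving DecidableEq

namespace AE

/-- Propositional evaluation of an autoepistemic formula, where `v` assigns
truth values to propositional variables and `w` assigns truth values to
`L`-prefixed formulas (which are treated as atoms). -/
def eval (v : ℕ → Bool) (w : AE → Bool) : AE → Bool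
  | var n => v n
  | top => true
  | bot => false
  | neg φ => !(eval v w φ)
  | conj φ ψ => eval v w φ && eval v w ψ
  | disj φ ψ => eval v w φ || eval v w ψ
  | xor φ ψ => (eval v w φ) != (eval v w ψ)
  | box φ => w φ

/-- Propositional consequence, treating `L`-prefixed formulas as atoms. -/
def entails (S : Set AE) (φ : AE) : Prop :=
  ∀ v w, (∀ ψ ∈ S, eval v w ψ = true) → eval v w φ = true

/-- Deductive closure. -/
def Th (S : Set AE) : Set AE := {φ | entails S φ}

/-- `Δ` is a stable expansion of `S` if `Δ = Th (S ∪ L(Δ) ∪ ¬L(Δᶜ))`. -/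
def IsStableExpansion (S Δ : Set AE) : Prop :=
  Δ = Th (S ∪ (box '' Δ) ∪ ((fun φ => neg (box φ)) '' Δᶜ))

/-- The set of subformulas of a formula (including the formula itself). -/
def subf : AE → Set AE
  | var n => {var n}
  | top => {top}
  | bot => {bot}
  | neg φ => insert (neg φ) (subf φ)
  | conj φ ψ => insert (conj φ ψ) (subf φ ∪ subf ψ)
  | disj φ ψ => insert (disj φ ψ) (subf φ ∪ subf ψ)
  | xor φ ψ => insert (xor φ ψ) (subf φ ∪ subf ψ)
  | box φ => insert (box φ) (subf φ)

/-- `SF^L(S)`: the `L`-prefixed subformulas of formulas in `S`. -/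
def SFL (S : Set AE) : Set AE := {χ | (∃ φ ∈ S, χ ∈ subf φ) ∧ ∃ ψ, χ = box ψ}

/-- `¬SF^L(S)`. -/
def negSFL (S : Set AE) : Set AE := neg '' SFL S

/-- `Λ` is an `S`-full set. -/
def IsFull (S Λ : Set AE) : Prop :=
  Λ ⊆ SFL S ∪ negSFL S ∧
  ∀ φ, box φ ∈ SFL S →
    (entails (S ∪ Λ) φ ↔ box φ ∈ Λ) ∧ (¬ entails (S ∪ Λ) φ ↔ neg (box φ) ∈ Λ)


/-- Translation of a 3-CNF literal `(xⱼ, b)` into a formula, where a negative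
literal `¬xⱼ` is replaced by the fresh primed variable `xⱼ'`:
`u` names the variables `xⱼ`, `p` names the primed variables `xⱼ'`. -/
def cnfLitForm {m : ℕ} (u p : Fin m → ℕ) : Fin m × Bool → AE
  | (j, true) => var (u j)
  | (j, false) => var (p j)

/-- The clause `cᵢ' = ℓᵢ₁ ∨ ℓᵢ₂ ∨ ℓᵢ₃` with negated variables primed. -/
def clauseForm {m : ℕ} (u p : Fin m → ℕ) (c : Fin 3 → Fin m × Bool) : AE :=
  disj (cnfLitForm u p (c 0)) (disj (cnfLitForm u p (c 1)) (cnfLitForm u p (c 2)))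

/-- `Σ = {Lcᵢ' : i} ∪ {xⱼ ∨ Lxⱼ', Lxⱼ ∨ xⱼ' : j}` for a 3-CNF with clauses `C`. -/
def sigmaCNF {k m : ℕ} (u p : Fin m → ℕ) (C : Fin k → Fin 3 → Fin m × Bool) : Set AE :=
  {φ | ∃ i : Fin k, φ = box (clauseForm u p (C i))} ∪
  {φ | ∃ j : Fin m, φ = disj (var (u j)) (box (var (p j)))} ∪
  {φ | ∃ j : Fin m, φ = disj (box (var (u j))) (var (p j))}

/-- `σ` satisfies the 3-CNF with clauses `C`. -/
def satCNF {k m : ℕ} (C : Fin k → Fin 3 → Fin m × Bool) (σ : Fin m → Bool) : Prop :=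
  ∀ i : Fin k, ∃ l : Fin 3, σ (C i l).1 = (C i l).2

open Classical in
/-- The valuation of `L`-prefixed formulas induced by a belief set `Δ`. -/
noncomputable def beliefVal (Δ : Set AE) (φ : AE) : Bool := decide (φ ∈ Δ)

lemma beliefVal_eq_true {Δ : Set AE} {φ : AE} : beliefVal Δ φ = true ↔ φ ∈ Δ := by
  simp [beliefVal]

/-- The propositional valuations satisfying `S` when `L` is interpreted by `Δ`. -/
def models (S Δ : Set AE) : Set (ℕ → Bool) :=
  {v | ∀ ψ ∈ S, eval v (beliefVal Δ) ψ = true}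

/-- `Δ` consists of the formulas valid over `V` when `L` is interpreted by `Δ`. -/
def IsTheoryOf (V : Set (ℕ → Bool)) (Δ : Set AE) : Prop :=
  ∀ φ, φ ∈ Δ ↔ ∀ v ∈ V, eval v (beliefVal Δ) φ = true

theorem isStableExpansion_iff (S Δ : Set AE) :
    IsStableExpansion S Δ ↔ IsTheoryOf (models S Δ) Δ := by
  have key : Th (S ∪ (box '' Δ) ∪ ((fun φ => neg (box φ)) '' Δᶜ)) =
      {φ | ∀ v ∈ models S Δ, eval v (beliefVal Δ) φ = true} := by
    ext φ
    constructor
    · intro h v hv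
      apply h
      rintro ψ ((hψ | ⟨χ, hχ, rfl⟩) | ⟨χ, hχ, rfl⟩)
      · exact hv ψ hψ
      · simpa [eval, beliefVal] using hχ
      · simpa [eval, beliefVal] using hχ
    · intro h v w hvw
      have hw : w = beliefVal Δ := by
        funext χ
        by_cases hχ : χ ∈ Δ
        · have := hvw (box χ) (Or.inl (Or.inr ⟨χ, hχ, rfl⟩))
          simpa [eval, beliefVal, hχ] using this
        · have := hvw (neg (box χ)) (Or.inr ⟨χ, hχ, rfl⟩)
          simpa [eval, beliefVal, hχ] using this
      subst hw
      exact h v fun ψ hψ => hvw ψ (Or.inl (Or.inl hψ))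
  unfold IsStableExpansion
  rw [key, Set.ext_iff]
  rfl

open Classical in
/-- Evaluation at the world `v` of the `S5` structure whose accessible worlds are `V`. -/
noncomputable def worldEval (V : Set (ℕ → Bool)) : AE → (ℕ → Bool) → Bool
  | var n, v => v n
  | top, _ => true
  | bot, _ => false
  | neg φ, v => !(worldEval V φ v)
  | conj φ ψ, v => worldEval V φ v && worldEval V ψ v
  | disj φ ψ, v => worldEval V φ v || worldEval V ψ v
  | xor φ ψ, v => (worldEval V φ v) != (worldEval V ψ v)
  | box φ, _ => decide (∀ v ∈ V, worldEval V φ v = true)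

/-- The formulas valid in the `S5` structure with worlds `V`. -/
def worldTheory (V : Set (ℕ → Bool)) : Set AE := {φ | ∀ v ∈ V, worldEval V φ v = true}

lemma eval_worldTheory (V : Set (ℕ → Bool)) (v : ℕ → Bool) (φ : AE) :
    eval v (beliefVal (worldTheory V)) φ = worldEval V φ v := by
  induction φ with
  | box φ _ =>
    rw [Bool.eq_iff_iff]
    simp [eval, worldEval, beliefVal_eq_true, worldTheory]
  | _ => simp_all [eval, worldEval]

theorem isTheoryOf_worldTheory (V : Set (ℕ → Bool)) : IsTheoryOf V (worldTheory V) := by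
  intro φ
  simp only [eval_worldTheory]
  rfl

theorem IsTheoryOf.eq_worldTheory {V : Set (ℕ → Bool)} {Δ : Set AE} (h : IsTheoryOf V Δ) :
    Δ = worldTheory V := by
  have key : ∀ φ v, eval v (beliefVal Δ) φ = worldEval V φ v := by
    intro φ
    induction φ with
    | box φ ih =>
      intro v
      rw [Bool.eq_iff_iff]
      simp [eval, worldEval, beliefVal_eq_true, h φ, ih]
    | _ => simp_all [eval, worldEval]
  ext φ
  rw [h φ]
  simp only [key]
  rfl

section CNF

variable {k m : ℕ} {u p : Fin m → ℕ}

/-- The index of the propositional variable representing a literal. -/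
def litIndex (u p : Fin m → ℕ) (l : Fin m × Bool) : ℕ := bif l.2 then u l.1 else p l.1

lemma cnfLitForm_eq (u p : Fin m → ℕ) (l : Fin m × Bool) :
    cnfLitForm u p l = var (litIndex u p l) := by
  obtain ⟨j, _ | _⟩ := l <;> rfl

lemma litIndex_injective
    (hinj : Function.Injective (Sum.elim u p : Fin m ⊕ Fin m → ℕ)) :
    Function.Injective (litIndex u p) := by
  rintro ⟨i, _ | _⟩ ⟨j, _ | _⟩ h
  · simpa using @hinj (Sum.inr i) (Sum.inr j) h
  · simpa using @hinj (Sum.inr i) (Sum.inl j) h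
  · simpa using @hinj (Sum.inl i) (Sum.inr j) h
  · simpa using @hinj (Sum.inl i) (Sum.inl j) h

lemma eval_clauseForm (v : ℕ → Bool) (w : AE → Bool) (c : Fin 3 → Fin m × Bool) :
    eval v w (clauseForm u p c) = true ↔ ∃ l, v (litIndex u p (c l)) = true := by
  simp [clauseForm, cnfLitForm_eq, eval, Fin.exists_fin_succ]

lemma mem_models_sigmaCNF {C : Fin k → Fin 3 → Fin m × Bool} {Δ : Set AE} {v : ℕ → Bool} :
    v ∈ models (sigmaCNF u p C) Δ ↔ (∀ i, clauseForm u p (C i) ∈ Δ) ∧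
      ∀ j b, v (litIndex u p (j, b)) = true ∨ var (litIndex u p (j, !b)) ∈ Δ := by
  constructor
  · intro h
    refine ⟨fun i => ?_, fun j b => ?_⟩
    · simpa [eval, beliefVal] using h _ (Or.inl (Or.inl ⟨i, rfl⟩))
    · cases b
      · simpa [eval, beliefVal, litIndex, or_comm] using h _ (Or.inr ⟨j, rfl⟩)
      · simpa [eval, beliefVal, litIndex] using h _ (Or.inl (Or.inr ⟨j, rfl⟩))
  · rintro ⟨hC, hv⟩ ψ ((⟨i, rfl⟩ | ⟨j, rfl⟩) | ⟨j, rfl⟩)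
    · simpa [eval, beliefVal] using hC i
    · simpa [eval, beliefVal, litIndex] using hv j true
    · simpa [eval, beliefVal, litIndex, or_comm] using hv j false

/-- The valuations making every literal true under `σ` true. -/
def litWorlds (u p : Fin m → ℕ) (σ : Fin m → Bool) : Set (ℕ → Bool) :=
  {v | ∀ j, v (litIndex u p (j, σ j)) = true}

/-- The least valuation in `litWorlds u p σ`. -/
def leastWorld (u p : Fin m → ℕ) (σ : Fin m → Bool) (n : ℕ) : Bool :=
  decide (∃ j, litIndex u p (j, σ j) = n)

lemma leastWorld_mem (σ : Fin m → Bool) : leastWorld u p σ ∈ litWorlds u p σ := by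
  intro j
  simp only [leastWorld, decide_eq_true_eq]
  exact ⟨j, rfl⟩

lemma leastWorld_litIndex
    (hinj : Function.Injective (Sum.elim u p : Fin m ⊕ Fin m → ℕ))
    (σ : Fin m → Bool) (l : Fin m × Bool) :
    leastWorld u p σ (litIndex u p l) = true ↔ σ l.1 = l.2 := by
  simp only [leastWorld, decide_eq_true_eq, (litIndex_injective hinj).eq_iff]
  constructor
  · rintro ⟨j, rfl⟩
    rfl
  · intro h
    exact ⟨l.1, by rw [h]⟩

lemma var_mem_iff_of_isTheoryOf_litWorlds
    (hinj : Function.Injective (Sum.elim u p : Fin m ⊕ Fin m → ℕ))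
    {σ : Fin m → Bool} {Δ : Set AE} (h : IsTheoryOf (litWorlds u p σ) Δ) (l : Fin m × Bool) :
    var (litIndex u p l) ∈ Δ ↔ σ l.1 = l.2 := by
  rw [h]
  constructor
  · intro hv
    exact (leastWorld_litIndex hinj σ l).1 (hv _ (leastWorld_mem σ))
  · intro hl v hv
    have := hv l.1
    rwa [hl] at this

lemma clauseForm_mem_iff_of_isTheoryOf_litWorlds
    (hinj : Function.Injective (Sum.elim u p : Fin m ⊕ Fin m → ℕ))
    {σ : Fin m → Bool} {Δ : Set AE} (h : IsTheoryOf (litWorlds u p σ) Δ)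
    (c : Fin 3 → Fin m × Bool) :
    clauseForm u p c ∈ Δ ↔ ∃ l, σ (c l).1 = (c l).2 := by
  rw [h]
  simp only [eval_clauseForm]
  constructor
  · intro hv
    simpa only [leastWorld_litIndex hinj] using hv _ (leastWorld_mem σ)
  · rintro ⟨l, hl⟩ v hv
    have := hv (c l).1
    rw [hl] at this
    exact ⟨l, this⟩

lemma models_sigmaCNF_eq_litWorlds {C : Fin k → Fin 3 → Fin m × Bool} {Δ : Set AE}
    {σ : Fin m → Bool} (hC : ∀ i, clauseForm u p (C i) ∈ Δ)
    (hσ : ∀ j b, var (litIndex u p (j, b)) ∈ Δ ↔ σ j = b) :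
    models (sigmaCNF u p C) Δ = litWorlds u p σ := by
  ext v
  rw [mem_models_sigmaCNF]
  simp only [hσ, hC, implies_true, true_and]
  constructor
  · intro h j
    simpa using h j (σ j)
  · intro h j b
    have := h j
    by_cases hb : σ j = b
    · exact Or.inl (hb ▸ this)
    · exact Or.inr (Bool.eq_not.2 hb)

theorem isStableExpansion_sigmaCNF_iff
    (hinj : Function.Injective (Sum.elim u p : Fin m ⊕ Fin m → ℕ))
    (C : Fin k → Fin 3 → Fin m × Bool) (Δ : Set AE) :
    IsStableExpansion (sigmaCNF u p C) Δ ↔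
      ∃ σ, satCNF C σ ∧ worldTheory (litWorlds u p σ) = Δ := by
  classical
  rw [isStableExpansion_iff]
  constructor
  · intro h
    have hC : ∀ i, clauseForm u p (C i) ∈ Δ := by
      intro i
      by_contra hi
      exact hi ((h _).2 fun v hv => absurd ((mem_models_sigmaCNF.1 hv).1 i) hi)
    have hexcl : ∀ j b, var (litIndex u p (j, b)) ∈ Δ ↔ var (litIndex u p (j, !b)) ∉ Δ := by
      intro j b
      constructor
      · intro hb hnb
        have hmem : (fun n => decide (n ≠ litIndex u p (j, b))) ∈
            models (sigmaCNF u p C) Δ := by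
          refine mem_models_sigmaCNF.2 ⟨hC, fun i b' => ?_⟩
          by_cases hi : (i, b') = (j, b)
          · obtain ⟨rfl, rfl⟩ := Prod.mk.inj hi
            exact Or.inr hnb
          · exact Or.inl (decide_eq_true ((litIndex_injective hinj).ne hi))
        simpa [eval] using (h _).1 hb _ hmem
      · intro hnb
        exact (h _).2 fun v hv => ((mem_models_sigmaCNF.1 hv).2 j b).resolve_right hnb
    let σ : Fin m → Bool := fun j => decide (var (litIndex u p (j, true)) ∈ Δ)
    have hσ : ∀ j b, var (litIndex u p (j, b)) ∈ Δ ↔ σ j = b := by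
      intro j b
      cases b
      · simpa [σ] using hexcl j false
      · simp [σ]
    rw [models_sigmaCNF_eq_litWorlds hC hσ] at h
    exact ⟨σ, fun i => (clauseForm_mem_iff_of_isTheoryOf_litWorlds hinj h _).1 (hC i),
      h.eq_worldTheory.symm⟩
  · rintro ⟨σ, hsat, rfl⟩
    have h := isTheoryOf_worldTheory (litWorlds u p σ)
    rwa [models_sigmaCNF_eq_litWorlds (σ := σ)
      (fun i => (clauseForm_mem_iff_of_isTheoryOf_litWorlds hinj h _).2 (hsat i))
      (fun j b => var_mem_iff_of_isTheoryOf_litWorlds hinj h (j, b))]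

lemma worldTheory_litWorlds_injective
    (hinj : Function.Injective (Sum.elim u p : Fin m ⊕ Fin m → ℕ)) :
    Function.Injective fun σ : Fin m → Bool => worldTheory (litWorlds u p σ) := by
  intro σ τ h
  funext j
  have hσ := var_mem_iff_of_isTheoryOf_litWorlds hinj
    (isTheoryOf_worldTheory (litWorlds u p σ)) (j, τ j)
  rw [show worldTheory (litWorlds u p σ) = worldTheory (litWorlds u p τ) from h,
    var_mem_iff_of_isTheoryOf_litWorlds hinj (isTheoryOf_worldTheory _)] at hσ
  exact hσ.1 rfl

end CNF

/-- The number of stable expansions of `Σ` equals the number of satisfying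
assignments of the 3-CNF `φ = ⋀ᵢ cᵢ` (the reduction is parsimonious). -/
theorem sigmaCNF_parsimonious (k m : ℕ) (u p : Fin m → ℕ)
    (hinj : Function.Injective (Sum.elim u p : Fin m ⊕ Fin m → ℕ))
    (C : Fin k → Fin 3 → Fin m × Bool) :
    {Δ : Set AE | IsStableExpansion (sigmaCNF u p C) Δ}.ncard =
    {σ : Fin m → Bool | satCNF C σ}.ncard := by
  rw [← Set.ncard_image_of_injective _ (worldTheory_litWorlds_injective hinj)]
  congr 1
  ext Δ
  exact isStableExpansion_sigmaCNF_iff hinj C Δ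

end AE
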